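/- Define φ(p, q) = e^{i(q−p)/2} / sin((q−p)/2). Let w : ℝ → ℂ be integrable on the interval [−π, π], and let q₁, q₂ ∈ ℂ with Im q₁ ≠ 0, Im q₂ ≠ 0 and sin((q₁−q₂)/2) ≠ 0. Set ṽ(q) = ∫_{−π}^{π} w(p)·φ(p, q) dp and Ṽ(q₁, q₂) = ∫_{−π}^{π} w(p)·φ(p, q₁)·φ(p, q₂) dp (all integrands are integrable since p ↦ φ(p, qᵢ) is bounded on ℝ when Im qᵢ ≠ 0). Then Ṽ(q₁, q₂) = ( e^{i(q₁−q₂)/2}·ṽ(q₂) − e^{−i(q₁−q₂)/2}·ṽ(q₁) ) / sin((q₁−q₂)/2). -/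

import Mathlib

open Complex Real MeasureTheory intervalIntegral

/-- The function `φ(p, q) = e^{i(q−p)/2}/sin((q−p)/2)` entering the kernel of the Fredholm
determinant, with `p` real. -/
noncomputable def phi (p : ℝ) (q : ℂ) : ℂ :=
  Complex.exp (Complex.I * (q - (p : ℂ)) / 2) / Complex.sin ((q - (p : ℂ)) / 2)

/-- For `q` off the real axis, `sin ((q - p) / 2)` does not vanish at real `p`. -/
lemma sin_half_sub_ofReal_ne_zero {q : ℂ} (hq : q.im ≠ 0) (p : ℝ) :
    Complex.sin ((q - (p : ℂ)) / 2) ≠ 0 := by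
  rw [Ne, Complex.sin_eq_zero_iff]
  rintro ⟨k, hk⟩
  have hq' : q = ((p + 2 * (k * π) : ℝ) : ℂ) := by
    push_cast
    linear_combination 2 * hk
  exact hq (by rw [hq', Complex.ofReal_im])

lemma continuous_phi {q : ℂ} (hq : q.im ≠ 0) : Continuous fun p : ℝ => phi p q := by
  unfold phi
  exact Continuous.div (by fun_prop) (by fun_prop) (sin_half_sub_ofReal_ne_zero hq)

/-- The addition formula behind the integrable form of the kernel. -/
lemma exp_mul_exp_mul_sin_sub (a b : ℂ) :
    Complex.exp (I * a) * Complex.exp (I * b) * Complex.sin (a - b) =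
      Complex.exp (I * a) * Complex.sin a - Complex.exp (I * b) * Complex.sin b := by
  rw [Complex.sin_sub, mul_comm I a, mul_comm I b, Complex.exp_mul_I, Complex.exp_mul_I]
  linear_combination
    (Complex.sin a ^ 2 * Complex.cos b * Complex.sin b -
      Complex.cos a * Complex.sin a * Complex.sin b ^ 2) * Complex.I_sq +
    (Complex.cos a + Complex.sin a * I) * Complex.sin a * Complex.sin_sq_add_cos_sq b -
    (Complex.cos b + Complex.sin b * I) * Complex.sin b * Complex.sin_sq_add_cos_sq a

lemma phi_mul_phi {q₁ q₂ : ℂ} (h1 : q₁.im ≠ 0) (h2 : q₂.im ≠ 0)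
    (h12 : Complex.sin ((q₁ - q₂) / 2) ≠ 0) (p : ℝ) :
    phi p q₁ * phi p q₂ =
      (Complex.exp (I * (q₁ - q₂) / 2) * phi p q₂
        - Complex.exp (-(I * (q₁ - q₂) / 2)) * phi p q₁) / Complex.sin ((q₁ - q₂) / 2) := by
  have hs₁ := sin_half_sub_ofReal_ne_zero h1 p
  have hs₂ := sin_half_sub_ofReal_ne_zero h2 p
  have key := exp_mul_exp_mul_sin_sub ((q₁ - p) / 2) ((q₂ - p) / 2)
  have e₁ : Complex.exp (I * (q₁ - q₂) / 2) * Complex.exp (I * (q₂ - p) / 2) =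
      Complex.exp (I * ((q₁ - p) / 2)) := by
    rw [← Complex.exp_add]; ring_nf
  have e₂ : Complex.exp (-(I * (q₁ - q₂) / 2)) * Complex.exp (I * (q₁ - p) / 2) =
      Complex.exp (I * ((q₂ - p) / 2)) := by
    rw [← Complex.exp_add]; ring_nf
  rw [show (q₁ - p) / 2 - (q₂ - p) / 2 = (q₁ - q₂) / 2 by ring] at key
  rw [eq_div_iff h12]
  unfold phi
  rw [← mul_div_assoc (Complex.exp (I * (q₁ - q₂) / 2)),
    ← mul_div_assoc (Complex.exp (-(I * (q₁ - q₂) / 2))), e₁, e₂, div_mul_div_comm,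
    div_mul_eq_mul_div, div_sub_div _ _ hs₂ hs₁, mul_div_assoc I (q₁ - p),
    mul_div_assoc I (q₂ - p), key]
  ring

/-- The kernel `Ṽ(q₁,q₂) = ∫_{−π}^{π} w(p) φ(p,q₁) φ(p,q₂) dp` is of integrable type:
it equals `(e^{i(q₁−q₂)/2} ṽ(q₂) − e^{−i(q₁−q₂)/2} ṽ(q₁)) / sin((q₁−q₂)/2)`, where
`ṽ(q) = ∫_{−π}^{π} w(p) φ(p,q) dp`. -/
theorem kernel_integrable_type (w : ℝ → ℂ)
    (hw : IntervalIntegrable w MeasureTheory.volume (-π) π)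
    (q₁ q₂ : ℂ) (h1 : q₁.im ≠ 0) (h2 : q₂.im ≠ 0)
    (h12 : Complex.sin ((q₁ - q₂) / 2) ≠ 0) :
    (∫ p in (-π : ℝ)..π, w p * phi p q₁ * phi p q₂)
      = (Complex.exp (Complex.I * (q₁ - q₂) / 2) * (∫ p in (-π : ℝ)..π, w p * phi p q₂)
          - Complex.exp (-(Complex.I * (q₁ - q₂) / 2)) * (∫ p in (-π : ℝ)..π, w p * phi p q₁))
        / Complex.sin ((q₁ - q₂) / 2) := by
  have i₁ := hw.mul_continuousOn (continuous_phi h1).continuousOn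
  have i₂ := hw.mul_continuousOn (continuous_phi h2).continuousOn
  rw [← intervalIntegral.integral_const_mul, ← intervalIntegral.integral_const_mul,
    ← intervalIntegral.integral_sub (i₂.const_mul _) (i₁.const_mul _),
    ← intervalIntegral.integral_div]
  congr 1 with p
  rw [mul_assoc, phi_mul_phi h1 h2 h12]
  ring
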